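/- With u as defined in the context: for every z with 0 ≤ z < h, u(z, t) → 0 as t → 0⁺; that is, the series solution attains the zero initial condition pointwise on [0, h). -/

import Mathlib

open Filter Topology Real

lemma aux_sum (x : ℝ) (K : ℕ) :
    2 * Real.cos x * ∑ k ∈ Finset.range K, (-1 : ℝ)^k * Real.sin ((2 * k + 1) * x)
      = -((-1 : ℝ)^K * Real.sin (2 * K * x)) := by
  induction K with
  | zero => simp
  | succ n ih =>
    rw [Finset.sum_range_succ, mul_add, ih]
    have h1 : Real.sin (2 * n * x) = Real.sin ((2 * n + 1) * x) * Real.cos x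
        - Real.cos ((2 * n + 1) * x) * Real.sin x := by
      rw [← Real.sin_sub]; congr 1; ring
    have h2 : Real.sin (2 * (n + 1 : ℕ) * x) = Real.sin ((2 * n + 1) * x) * Real.cos x
        + Real.cos ((2 * n + 1) * x) * Real.sin x := by
      rw [← Real.sin_add]; congr 1; push_cast; ring
    rw [h1, h2, pow_succ]; ring

lemma aux_bound (θ : ℝ) (h0 : 0 ≤ θ) (h1 : θ < π / 2) (K : ℕ) (hK : 0 < K) :
    |(∑ k ∈ Finset.range K, (-1 : ℝ)^k * Real.cos ((2 * k + 1) * θ) / (2 * k + 1))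
      - ∑ k ∈ Finset.range K, (-1 : ℝ)^k / (2 * k + 1)|
      ≤ (θ / (4 * Real.cos θ ^ 2) + 1 / (4 * Real.cos θ) + 1 / 4) / K := by
  have hKr : (0 : ℝ) < K := by exact_mod_cast hK
  have hc : 0 < Real.cos θ := Real.cos_pos_of_mem_Ioo ⟨by linarith [Real.pi_pos], h1⟩
  set G : ℝ → ℝ := fun x => (∑ k ∈ Finset.range K, (-1 : ℝ)^k * Real.cos ((2 * k + 1) * x) / (2 * k + 1))
    + (-1 : ℝ)^K * Real.cos (2 * K * x) / (4 * K * Real.cos x) with hG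
  have hder : ∀ x ∈ Set.Icc 0 θ, HasDerivWithinAt G
      ((-1 : ℝ)^K * Real.cos (2 * K * x) * Real.sin x / (4 * K * Real.cos x ^ 2)) (Set.Icc 0 θ) x := by
    intro x hx
    have hcx : 0 < Real.cos x := Real.cos_pos_of_mem_Ioo
      ⟨by linarith [Real.pi_pos, hx.1], by linarith [hx.2]⟩
    have e1 : HasDerivAt (fun x : ℝ => ∑ k ∈ Finset.range K, (-1 : ℝ)^k * Real.cos ((2 * k + 1) * x) / (2 * k + 1))
        (∑ k ∈ Finset.range K, -((-1 : ℝ)^k * Real.sin ((2 * k + 1) * x))) x := by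
      apply HasDerivAt.fun_sum
      intro k _
      have hk : (2 * (k : ℝ) + 1) ≠ 0 := by positivity
      have := ((((hasDerivAt_id x).const_mul (2 * (k : ℝ) + 1)).cos).const_mul ((-1 : ℝ)^k)).div_const (2 * (k : ℝ) + 1)
      refine HasDerivAt.congr_deriv this ?_
      simp only [id]
      field_simp
    have e2 : HasDerivAt (fun x : ℝ => (-1 : ℝ)^K * Real.cos (2 * K * x) / (4 * K * Real.cos x)) _ x :=
      ((((hasDerivAt_id x).const_mul (2 * (K : ℝ))).cos).const_mul ((-1 : ℝ)^K)).div
        ((Real.hasDerivAt_cos x).const_mul (4 * (K : ℝ))) (by positivity)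
    have e3 := e1.add e2
    refine HasDerivAt.hasDerivWithinAt ?_
    refine HasDerivAt.congr_deriv (f := G) e3 ?_
    have := aux_sum x K
    rw [Finset.sum_neg_distrib]
    have h' : ∑ k ∈ Finset.range K, (-1 : ℝ)^k * Real.sin ((2 * k + 1) * x)
      = -((-1 : ℝ)^K * Real.sin (2 * K * x)) / (2 * Real.cos x) := by
      rw [← this, mul_div_cancel_left₀ _ (by positivity)]
    rw [h']
    simp only [id]
    field_simp
    ring
  have hb : ∀ x ∈ Set.Ico 0 θ, ‖(-1 : ℝ)^K * Real.cos (2 * K * x) * Real.sin x / (4 * K * Real.cos x ^ 2)‖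
      ≤ 1 / (4 * K * Real.cos θ ^ 2) := by
    intro x hx
    have hcx : Real.cos θ ≤ Real.cos x :=
      Real.cos_le_cos_of_nonneg_of_le_pi hx.1 (by linarith [Real.pi_pos]) hx.2.le
    rw [norm_div, norm_mul, norm_mul, norm_pow, norm_neg, norm_one, one_pow, one_mul]
    rw [Real.norm_of_nonneg (by positivity : 0 ≤ 4 * (K:ℝ) * Real.cos x ^ 2)]
    gcongr
    exact mul_le_one₀ (Real.abs_cos_le_one _) (norm_nonneg _) (Real.abs_sin_le_one _)
  have key := norm_image_sub_le_of_norm_deriv_le_segment' hder hb θ ⟨h0, le_rfl⟩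
  have b1 : |(-1 : ℝ)^K * Real.cos (2 * K * θ) / (4 * K * Real.cos θ)| ≤ 1 / (4 * K * Real.cos θ) := by
    rw [abs_div, abs_mul, abs_pow, abs_neg, abs_one, one_pow, one_mul,
      abs_of_pos (by positivity : 0 < 4 * (K:ℝ) * Real.cos θ)]
    gcongr
    exact Real.abs_cos_le_one _
  have b2 : |(-1 : ℝ)^K / (4 * K)| ≤ 1 / (4 * K) := by
    rw [abs_div, abs_pow, abs_neg, abs_one, one_pow,
      abs_of_pos (by positivity : 0 < 4 * (K:ℝ))]
  simp only [hG, mul_zero, Real.cos_zero, mul_one, sub_zero, Real.norm_eq_abs] at key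
  have e : (θ / (4 * Real.cos θ ^ 2) + 1 / (4 * Real.cos θ) + 1 / 4) / K
    = 1 / (4 * K * Real.cos θ ^ 2) * θ + 1 / (4 * K * Real.cos θ) + 1 / (4 * K) := by
    field_simp
  rw [e]
  rw [abs_le] at *
  constructor <;> linarith [key.1, key.2, b1.1, b1.2, b2.1, b2.2]

lemma aux_lim (θ : ℝ) (h0 : 0 ≤ θ) (h1 : θ < π / 2) :
    Tendsto (fun K : ℕ => ∑ k ∈ Finset.range K, (-1 : ℝ)^k * Real.cos ((2 * k + 1) * θ) / (2 * k + 1))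
      atTop (𝓝 (π / 4)) := by
  have hd : Tendsto (fun K : ℕ => (∑ k ∈ Finset.range K, (-1 : ℝ)^k * Real.cos ((2 * k + 1) * θ) / (2 * k + 1))
      - ∑ k ∈ Finset.range K, (-1 : ℝ)^k / (2 * k + 1)) atTop (𝓝 0) := by
    refine squeeze_zero_norm' ?_ (tendsto_const_div_atTop_nhds_zero_nat
      (θ / (4 * Real.cos θ ^ 2) + 1 / (4 * Real.cos θ) + 1 / 4))
    filter_upwards [eventually_gt_atTop 0] with K hK
    exact aux_bound θ h0 h1 K hK
  have := hd.add Real.tendsto_sum_pi_div_four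
  simpa using this

lemma aux_abel (a w : ℕ → ℝ) (L ε : ℝ) (N : ℕ) (hw : Antitone w) (hw0 : ∀ k, 0 ≤ w k)
    (hw1 : ∀ k, w k ≤ 1) (hε : 0 ≤ ε)
    (hN : ∀ n ≥ N, |(∑ k ∈ Finset.range n, a k) - L| ≤ ε) (n : ℕ) (hn : N ≤ n) :
    |(∑ k ∈ Finset.range n, a k * w k) - ∑ k ∈ Finset.range N, a k * w k| ≤ 2 * ε := by
  have key : |(∑ k ∈ Finset.range n, a k * w k) - (∑ k ∈ Finset.range N, a k * w k)
      - ((∑ k ∈ Finset.range n, a k) - L) * w n + ((∑ k ∈ Finset.range N, a k) - L) * w N|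
      ≤ ε * (w N - w n) := by
    induction n, hn using Nat.le_induction with
    | base => simp
    | succ n hn ih =>
      have hd : 0 ≤ w n - w (n + 1) := sub_nonneg.2 (hw n.le_succ)
      have h3 : |((∑ k ∈ Finset.range (n + 1), a k) - L) * (w n - w (n + 1))| ≤ ε * (w n - w (n + 1)) := by
        rw [abs_mul, abs_of_nonneg hd]
        exact mul_le_mul_of_nonneg_right (hN _ (by omega)) hd
      calc _ = |((∑ k ∈ Finset.range n, a k * w k) - (∑ k ∈ Finset.range N, a k * w k)
              - ((∑ k ∈ Finset.range n, a k) - L) * w n + ((∑ k ∈ Finset.range N, a k) - L) * w N)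
              + ((∑ k ∈ Finset.range (n + 1), a k) - L) * (w n - w (n + 1))| := by
            congr 1
            simp only [Finset.sum_range_succ]
            ring
        _ ≤ _ := (abs_add_le _ _).trans (by linarith)
  have g1 : |((∑ k ∈ Finset.range n, a k) - L) * w n| ≤ ε * w n := by
    rw [abs_mul, abs_of_nonneg (hw0 n)]
    exact mul_le_mul_of_nonneg_right (hN _ hn) (hw0 n)
  have g2 : |((∑ k ∈ Finset.range N, a k) - L) * w N| ≤ ε * w N := by
    rw [abs_mul, abs_of_nonneg (hw0 N)]
    exact mul_le_mul_of_nonneg_right (hN _ le_rfl) (hw0 N)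
  have g3 : ε * w N ≤ ε := mul_le_of_le_one_right hε (hw1 N)
  rw [abs_le] at *
  constructor <;> linarith [key.1, key.2, g1.1, g1.2, g2.1, g2.2]

lemma aux_main (a : ℕ → ℝ) (L c : ℝ) (hc : 0 < c) (ha : ∀ k, |a k| ≤ 1)
    (hL : Tendsto (fun n : ℕ => ∑ k ∈ Finset.range n, a k) atTop (𝓝 L)) :
    Tendsto (fun t : ℝ => ∑' k : ℕ, a k * Real.exp (-(2 * k + 1)^2 * (c * t))) (𝓝[>] 0) (𝓝 L) := by
  rw [Metric.tendsto_nhds]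
  intro e he
  obtain ⟨N, hN⟩ := (Metric.tendsto_atTop.1 hL) (e / 5) (by positivity)
  have hN' : ∀ n ≥ N, |(∑ k ∈ Finset.range n, a k) - L| ≤ e / 5 := fun n hn => (hN n hn).le
  have hfin : Tendsto (fun t : ℝ => ∑ k ∈ Finset.range N, a k * Real.exp (-(2 * k + 1)^2 * (c * t)))
      (𝓝[>] 0) (𝓝 (∑ k ∈ Finset.range N, a k)) := by
    refine tendsto_nhdsWithin_of_tendsto_nhds ?_
    have : Continuous (fun t : ℝ => ∑ k ∈ Finset.range N, a k * Real.exp (-(2 * k + 1)^2 * (c * t))) := by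
      fun_prop
    simpa using this.tendsto 0
  filter_upwards [(Metric.tendsto_nhds.1 hfin) (e / 5) (by positivity), self_mem_nhdsWithin] with t ht1 ht
  have ht : 0 < t := ht
  have hct : 0 < c * t := by positivity
  have hsum : Summable (fun k : ℕ => a k * Real.exp (-(2 * k + 1)^2 * (c * t))) := by
    have hg : Summable (fun k : ℕ => Real.exp (-(c * t)) ^ k) :=
      summable_geometric_of_lt_one (Real.exp_pos _).le (by simpa using hct)
    refine Summable.of_norm_bounded hg ?_
    intro k
    rw [norm_mul, Real.norm_eq_abs, Real.norm_of_nonneg (Real.exp_pos _).le, ← Real.exp_nat_mul]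
    have : Real.exp (-(2 * k + 1)^2 * (c * t)) ≤ Real.exp (k * -(c * t)) := by
      apply Real.exp_le_exp.2
      have : (k : ℝ) ≤ (2 * k + 1)^2 := by nlinarith [(Nat.cast_nonneg k : (0:ℝ) ≤ k)]
      nlinarith
    nlinarith [ha k, abs_nonneg (a k), Real.exp_pos (-(2 * k + 1)^2 * (c * t))]
  have hb := aux_abel a (fun k : ℕ => Real.exp (-(2 * k + 1)^2 * (c * t))) L (e / 5) N
    (by
      intro i j hij
      apply Real.exp_le_exp.2
      have hij' : (i : ℝ) ≤ j := by exact_mod_cast hij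
      have : (2 * (i : ℝ) + 1)^2 ≤ (2 * j + 1)^2 := by gcongr
      nlinarith)
    (fun k => (Real.exp_pos _).le)
    (fun k => by
      apply Real.exp_le_one_iff.2
      have : 0 ≤ (2 * (k : ℝ) + 1)^2 * (c * t) := by positivity
      linarith)
    (by positivity) hN'
  have hlim := (hsum.hasSum.tendsto_sum_nat.sub_const
    (∑ k ∈ Finset.range N, a k * Real.exp (-(2 * k + 1)^2 * (c * t)))).abs
  have hle := le_of_tendsto hlim (by
    filter_upwards [eventually_ge_atTop N] with n hn using hb n hn)
  have h4 := hN' N le_rfl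
  rw [Real.dist_eq] at *
  have := abs_lt.1 ht1
  rw [abs_le] at *
  rw [abs_lt]
  constructor <;> linarith [hle.1, hle.2, h4.1, h4.2, this.1, this.2]

/-- The series solution `u` attains the zero initial condition pointwise on
`[0,h)`: for every `z` with `0 ≤ z < h`, `u(z,t) → 0` as `t → 0⁺`. -/
theorem stmt_11 (u_wall h ν : ℝ) (hh : 0 < h) (hν : 0 < ν)
    (u : ℝ → ℝ → ℝ)
    (hu : ∀ z t, u z t = u_wall *
      (1 - ∑' k : ℕ, 4 * (-1 : ℝ)^k / ((2 * k + 1) * π)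
          * Real.exp (-(2 * k + 1)^2 * π^2 * ν * t / (4 * h^2))
          * Real.cos ((2 * k + 1) * π * z / (2 * h)))) :
    ∀ z : ℝ, 0 ≤ z → z < h →
      Tendsto (fun t => u z t) (𝓝[>] (0 : ℝ)) (𝓝 0) := by
  intro z hz0 hzh
  have hθ0 : 0 ≤ π * z / (2 * h) := by positivity
  have hθ1 : π * z / (2 * h) < π / 2 := by
    rw [div_lt_div_iff₀ (by positivity) (by norm_num)]
    nlinarith [Real.pi_pos]
  have hm := aux_main _ (π / 4) (π^2 * ν / (4 * h^2)) (by positivity) (by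
    intro k
    rw [abs_div, abs_mul, abs_pow, abs_neg, abs_one, one_pow, one_mul,
      abs_of_pos (by positivity : 0 < 2 * (k:ℝ) + 1)]
    exact div_le_one_of_le₀ ((Real.abs_cos_le_one _).trans
      (by linarith [(Nat.cast_nonneg k : (0:ℝ) ≤ k)])) (by positivity)) (aux_lim _ hθ0 hθ1)
  have h2 := ((hm.const_mul (4 / π)).const_sub 1).const_mul u_wall
  have e : u_wall * (1 - 4 / π * (π / 4)) = 0 := by
    field_simp
    simp
  rw [e] at h2
  refine h2.congr ?_
  intro t
  rw [hu, ← tsum_mul_left]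
  congr 3
  ext k
  have e1 : (2 * (k:ℝ) + 1) * (π * z / (2 * h)) = (2 * k + 1) * π * z / (2 * h) := by ring
  have e2 : -(2 * (k:ℝ) + 1)^2 * (π^2 * ν / (4 * h^2) * t) = -(2 * k + 1)^2 * π^2 * ν * t / (4 * h^2) := by ring
  rw [e1, e2]
  field_simp
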